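/- Let μ be a non-negative integer and let c, d be non-negative integers with c ≥ μd. Then (c+d+1) times the number of lattice paths from (0,0) to (c,d) with steps (1,0) and (0,1), all of whose points (x,y) satisfy x ≥ μy, equals (c − μd + 1)·C(c+d+1, d). -/

import Mathlib

/-- The set of lattice paths (as lists of their points) from `A` to `E` in `ℤ²`
with steps `(1,0)` and `(0,1)`, all of whose points satisfy the condition `C`. -/
def SPaths (A E : ℤ × ℤ) (C : ℤ × ℤ → Prop) : Set (List (ℤ × ℤ)) :=
  {p | p.head? = some A ∧ p.getLast? = some E ∧
       List.Chain' (fun q q' => q' - q = ((1 : ℤ), (0 : ℤ)) ∨ q' - q = ((0 : ℤ), (1 : ℤ))) p ∧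
       ∀ q ∈ p, C q}

/-- Binomial coefficient `C(n,k)` for integer arguments, `0` unless `0 ≤ k ≤ n`. -/
def ibinom (n k : ℤ) : ℤ :=
  if 0 ≤ k ∧ k ≤ n then (Nat.choose n.toNat k.toNat : ℤ) else 0


lemma SPaths_eq_empty_of_not {A E : ℤ × ℤ} {C : ℤ × ℤ → Prop} (h : ¬ C E) :
    SPaths A E C = ∅ := by
  ext p
  simp only [SPaths, Set.mem_ofPred_eq, Set.mem_empty_iff_false, iff_false]
  rintro ⟨-, hE, -, hC⟩
  exact h (hC E (List.mem_of_getLast? hE))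

/-- Splitting off the last point of a lattice path. -/
lemma append_mem_SPaths {A B E : ℤ × ℤ} {C : ℤ × ℤ → Prop} {q : List (ℤ × ℤ)} (hE : C E) :
    (q ++ [B]) ++ [E] ∈ SPaths A E C ↔ q ++ [B] ∈ SPaths A B C ∧
      (B = E - (1, 0) ∨ B = E - (0, 1)) := by
  have hstep : (E - B = (1, 0) ∨ E - B = (0, 1)) ↔ (B = E - (1, 0) ∨ B = E - (0, 1)) := by
    constructor <;> rintro (h | h)
    · left; rw [← h]; abel
    · right; rw [← h]; abel
    · left; rw [h]; abel
    · right; rw [h]; abel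
  have hhead : ((q ++ [B]) ++ [E]).head? = (q ++ [B]).head? := by cases q <;> rfl
  unfold SPaths
  rw [Set.mem_ofPred_eq, Set.mem_ofPred_eq, hhead, ← hstep]
  unfold List.Chain'
  rw [List.isChain_append (l₁ := q ++ [B])]
  simp only [List.getLast?_append, List.mem_append, List.mem_singleton]
  simp only [List.getLast?_singleton, Option.some_or, List.isChain_singleton, true_and,
    Option.mem_def, Option.some.injEq, List.head?_cons, forall_eq']
  constructor
  · rintro ⟨h1, ⟨h2, h3⟩, h4⟩
    exact ⟨⟨h1, h2, fun x hx => h4 x (Or.inl hx)⟩, h3⟩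
  · rintro ⟨⟨h1, h2, h4⟩, h3⟩
    exact ⟨h1, ⟨h2, h3⟩, by rintro x (hx | rfl); exacts [h4 x hx, hE]⟩

lemma exists_append_of_mem_SPaths {A E : ℤ × ℤ} {C : ℤ × ℤ → Prop} {p : List (ℤ × ℤ)}
    (hp : p ∈ SPaths A E C) : ∃ q, p = q ++ [E] := by
  obtain ⟨q, rfl⟩ := List.getLast?_eq_some_iff.1 hp.2.1
  exact ⟨q, rfl⟩

lemma le_of_mem_SPaths {A E : ℤ × ℤ} {C : ℤ × ℤ → Prop} {p : List (ℤ × ℤ)}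
    (hp : p ∈ SPaths A E C) : A ≤ E := by
  obtain ⟨q, rfl⟩ := exists_append_of_mem_SPaths hp
  induction q using List.reverseRecOn generalizing E with
  | nil =>
    have h := hp.1
    simp only [List.nil_append, List.head?_cons, Option.some.injEq] at h
    exact h.ge
  | append_singleton q B ih =>
    obtain ⟨hB, hs⟩ := (append_mem_SPaths (hp.2.2.2 E (by simp))).1 hp
    refine (ih hB).trans ?_
    rcases hs with rfl | rfl <;> simp [Prod.le_def]

lemma SPaths_eq_empty_of_not_le {A E : ℤ × ℤ} {C : ℤ × ℤ → Prop} (h : ¬ A ≤ E) :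
    SPaths A E C = ∅ :=
  Set.eq_empty_of_forall_notMem fun _ hp => h (le_of_mem_SPaths hp)

lemma SPaths_self {A : ℤ × ℤ} {C : ℤ × ℤ → Prop} (hA : C A) : SPaths A A C = {[A]} := by
  ext p
  rw [Set.mem_singleton_iff]
  constructor
  · intro hp
    obtain ⟨q, rfl⟩ := exists_append_of_mem_SPaths hp
    induction q using List.reverseRecOn with
    | nil => rfl
    | append_singleton q B =>
      obtain ⟨hB, hs⟩ := (append_mem_SPaths hA).1 hp
      have := le_of_mem_SPaths hB
      rcases hs with rfl | rfl <;> simp [Prod.le_def] at this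
  · rintro rfl
    simp only [SPaths, List.Chain', Set.mem_ofPred_eq, List.mem_singleton, forall_eq]
    simpa using hA

lemma SPaths_eq_image {A E : ℤ × ℤ} {C : ℤ × ℤ → Prop} (hE : C E) (hne : A ≠ E) :
    SPaths A E C =
      (fun q => q ++ [E]) '' (SPaths A (E - (1, 0)) C ∪ SPaths A (E - (0, 1)) C) := by
  ext p
  constructor
  · intro hp
    obtain ⟨q, rfl⟩ := exists_append_of_mem_SPaths hp
    refine ⟨q, ?_, rfl⟩
    induction q using List.reverseRecOn with
    | nil =>
      have h := hp.1
      simp only [List.nil_append, List.head?_cons, Option.some.injEq] at h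
      exact absurd h.symm hne
    | append_singleton q B =>
      obtain ⟨hB, rfl | rfl⟩ := (append_mem_SPaths hE).1 hp
      exacts [Or.inl hB, Or.inr hB]
  · rintro ⟨q, hq | hq, rfl⟩ <;> obtain ⟨r, rfl⟩ := exists_append_of_mem_SPaths hq
    · exact (append_mem_SPaths hE).2 ⟨hq, Or.inl rfl⟩
    · exact (append_mem_SPaths hE).2 ⟨hq, Or.inr rfl⟩

lemma encard_SPaths {A E : ℤ × ℤ} {C : ℤ × ℤ → Prop} (hE : C E) (hne : A ≠ E) :
    (SPaths A E C).encard =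
      (SPaths A (E - (1, 0)) C).encard + (SPaths A (E - (0, 1)) C).encard := by
  rw [SPaths_eq_image hE hne, (List.append_left_injective [E]).encard_image,
    Set.encard_union_eq]
  refine Set.disjoint_left.2 fun p h₁ h₂ => ?_
  have := h₁.2.1.symm.trans h₂.2.1
  simp [Prod.ext_iff] at this

/-- The number of lattice paths to `(c, d)` staying in `x ≥ μ y` is
`(μ + 1) C(c + d, d) - μ C(c + d + 1, d)`. -/
lemma exists_encard_SPaths_eq (μ d c : ℕ) (h : μ * d ≤ c) :
    ∃ k : ℕ, (SPaths (0, 0) ((c : ℤ), (d : ℤ)) (fun q => (μ : ℤ) * q.2 ≤ q.1)).encard = k ∧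
      k + μ * (c + d + 1).choose d = (μ + 1) * (c + d).choose d := by
  induction d generalizing c with
  | zero =>
    refine ⟨1, ?_, by simp; ring⟩
    induction c with
    | zero =>
      have := SPaths_self (A := (0, 0)) (C := fun q => (μ : ℤ) * q.2 ≤ q.1) (by simp)
      simp [this]
    | succ c ih =>
      have ih := ih (by simp)
      rw [encard_SPaths (by simp; positivity) (by simp [Prod.ext_iff]; omega),
        SPaths_eq_empty_of_not_le (E := _ - (0, 1)) (by simp [Prod.le_def])]
      simpa using ih
  | succ d ihd =>
    have hrec (c : ℕ) (h : μ * (d + 1) ≤ c) :=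
      encard_SPaths (A := (0, 0)) (E := ((c : ℤ), ((d + 1 : ℕ) : ℤ)))
        (C := fun q => (μ : ℤ) * q.2 ≤ q.1) (by dsimp only; exact_mod_cast h)
        (by simp [Prod.ext_iff]; omega)
    induction c with
    | zero =>
      obtain rfl : μ = 0 := by simpa using h
      obtain ⟨k, hk, hk'⟩ := ihd 0 (by simp)
      refine ⟨k, ?_, by simpa using hk'⟩
      rw [hrec 0 h, SPaths_eq_empty_of_not_le (E := _ - (1, 0)) (by simp [Prod.le_def])]
      simpa using hk
    | succ c ih =>
      obtain ⟨k, hk, hk'⟩ := ihd (c + 1) (by nlinarith)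
      have hleft : ∃ l : ℕ, (SPaths (0, 0) ((c : ℤ), ((d + 1 : ℕ) : ℤ))
          (fun q => (μ : ℤ) * q.2 ≤ q.1)).encard = l ∧
          l + μ * (c + (d + 1) + 1).choose (d + 1) = (μ + 1) * (c + (d + 1)).choose (d + 1) := by
        by_cases hc : μ * (d + 1) ≤ c
        · exact ih hc
        · refine ⟨0, ?_, ?_⟩
          · rw [SPaths_eq_empty_of_not (by dsimp only; exact_mod_cast hc)]
            simp
          · have hc' : c + 1 = μ * (d + 1) := by omega
            have habs := Nat.choose_mul_succ_eq (c + (d + 1)) (d + 1)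
            rw [show c + (d + 1) + 1 - (d + 1) = c + 1 by omega] at habs
            apply Nat.eq_of_mul_eq_mul_left (Nat.succ_pos d)
            rw [hc', show c + (d + 1) + 1 = (μ + 1) * (d + 1) by linarith] at habs
            rw [show c + (d + 1) + 1 = (μ + 1) * (d + 1) by linarith]
            rw [Nat.succ_eq_add_one]
            linarith
      obtain ⟨l, hl, hl'⟩ := hleft
      refine ⟨l + k, ?_, ?_⟩
      · rw [hrec _ h]
        simp only [Prod.mk_sub_mk, Nat.cast_add, Nat.cast_one, add_sub_cancel_right, sub_zero]
          at hl hk ⊢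
        rw [hl, hk]
      · have e₁ := Nat.choose_succ_succ' (c + d + 2) d
        have e₂ := Nat.choose_succ_succ' (c + d + 1) d
        rw [show c + 1 + (d + 1) = c + d + 2 by ring]
        rw [show c + (d + 1) = c + d + 1 by ring] at hl'
        rw [show c + 1 + d = c + d + 1 by ring] at hk'
        zify at e₁ e₂ hl' hk' ⊢
        linear_combination hl' + hk' + (μ : ℤ) * e₁ - (μ + 1 : ℤ) * e₂

theorem statement6 (μ c d : ℕ) (h : μ * d ≤ c) :
    (c + d + 1) * (SPaths (0, 0) ((c : ℤ), (d : ℤ)) (fun q => (μ : ℤ) * q.2 ≤ q.1)).ncard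
      = (c - μ * d + 1) * Nat.choose (c + d + 1) d := by
  obtain ⟨k, hk, hk'⟩ := exists_encard_SPaths_eq μ d c h
  rw [Set.ncard, hk, ENat.toNat_natCast]
  have habs := Nat.choose_mul_succ_eq (c + d) d
  rw [show c + d + 1 - d = c + 1 by omega] at habs
  obtain ⟨e, rfl⟩ := Nat.exists_eq_add_of_le h
  rw [Nat.add_sub_cancel_left]
  zify at habs hk' ⊢
  linear_combination (μ * d + e + d + 1 : ℤ) * hk' + (μ + 1 : ℤ) * habs
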